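/- Let K be a dense and nontrivial (K ≠ {0}) additive subgroup of ℝ and let c ∈ K with c > 0. Then any decomposition formula δ(x, x+c) is equivalent to an MTL_K formula. -/

import Mathlib

namespace MTLPaper

variable {K : AddSubgroup ℝ} {P : Type}

/-- `K ⊆ ℝ` is dense: between any two elements of `K` there is another element of `K`. -/
def DenseK (K : AddSubgroup ℝ) : Prop :=
  ∀ a ∈ K, ∀ b ∈ K, a < b → ∃ c ∈ K, a < c ∧ c < b

/-- A term of `FO_K`: a variable index together with a constant shift from `K`
(`(x, c)` denotes the term `x + c`; iterated shifts collapse since `K` is a group). -/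
abbrev Term (K : AddSubgroup ℝ) : Type := ℕ × K

/-- Value of a term under a valuation of the variables. -/
def Term.val (v : ℕ → ℝ) (t : Term K) : ℝ := v t.1 + (t.2 : ℝ)

/-- Formulas of the monadic logic of order and metric `FO_K`, over monadic predicates `P`. -/
inductive FO (K : AddSubgroup ℝ) (P : Type) : Type
  | tt : FO K P
  | atom : P → Term K → FO K P
  | lt : Term K → Term K → FO K P
  | conj : FO K P → FO K P → FO K P
  | neg : FO K P → FO K P
  | ex : ℕ → FO K P → FO K P

namespace FO

/-- Satisfaction of an `FO_K` formula over a signal `f` and a valuation `v`. -/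
def sat (f : ℝ → Set P) : FO K P → (ℕ → ℝ) → Prop
  | tt, _ => True
  | atom p t, v => p ∈ f (Term.val v t)
  | lt s t, v => Term.val v s < Term.val v t
  | conj φ ψ, v => sat f φ v ∧ sat f ψ v
  | neg φ, v => ¬ sat f φ v
  | ex x φ, v => ∃ r : ℝ, sat f φ (Function.update v x r)

/-- Free variables of an `FO_K` formula. -/
def free : FO K P → Set ℕ
  | tt => ∅
  | atom _ t => {t.1}
  | lt s t => {s.1, t.1}
  | conj φ ψ => free φ ∪ free ψ
  | neg φ => free φ
  | ex x φ => free φ \ {x}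

/-- Quantifier depth. -/
def qdepth : FO K P → ℕ
  | tt => 0
  | atom _ _ => 0
  | lt _ _ => 0
  | conj φ ψ => max (qdepth φ) (qdepth ψ)
  | neg φ => qdepth φ
  | ex _ φ => qdepth φ + 1

/-- Quantifier-free formulas. -/
def QFree : FO K P → Prop
  | tt => True
  | atom _ _ => True
  | lt _ _ => True
  | conj φ ψ => QFree φ ∧ QFree ψ
  | neg φ => QFree φ
  | ex _ _ => False

/-- `<`-free formulas. -/
def LtFree : FO K P → Prop
  | tt => True
  | atom _ _ => True
  | lt _ _ => False
  | conj φ ψ => LtFree φ ∧ LtFree ψ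
  | neg φ => LtFree φ
  | ex _ φ => LtFree φ

/-- Membership in `Bet_K(t₁,t₂)`: every quantified subformula `∃z ψ` has the form
`∃z ((t₁ < z < t₂) ∧ χ)`, and every monadic atom `P(t)` has `t` a bound occurrence of a
variable (no shift).  `B` records the set of variables bound so far. -/
def Bet (t₁ t₂ : Term K) : FO K P → Set ℕ → Prop
  | tt, _ => True
  | atom _ t, B => t.2 = (0 : K) ∧ t.1 ∈ B
  | lt _ _, _ => True
  | conj φ ψ, B => Bet t₁ t₂ φ B ∧ Bet t₁ t₂ ψ B
  | neg φ, B => Bet t₁ t₂ φ B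
  | ex z (conj (conj (lt s u) (lt u' t)) χ), B =>
      s = t₁ ∧ t = t₂ ∧ u = (z, (0 : K)) ∧ u' = (z, (0 : K)) ∧ Bet t₁ t₂ χ (insert z B)
  | ex _ _, _ => False

/-- `φ(x)` is `N`-bounded: it belongs to `Bet_K(x - N, x + N)`. -/
def NBounded (x : ℕ) (N : K) (φ : FO K P) : Prop :=
  Bet (x, -N) (x, N) φ (∅ : Set ℕ)

/-- The relativized quantifier `∃ y ∈ (s, t). φ`. -/
def guard (s t : Term K) (y : ℕ) (φ : FO K P) : FO K P :=
  ex y (conj (conj (lt s (y, (0 : K))) (lt (y, (0 : K)) t)) φ)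

/-- The guard interval of the body of a quantifier on `z`, if it has guarded shape. -/
def guardOf (z : ℕ) : FO K P → Set (Term K × Term K)
  | conj (conj (lt s u) (lt u' t)) _ =>
      {p | u = (z, (0 : K)) ∧ u' = (z, (0 : K)) ∧ p = (s, t)}
  | _ => ∅

/-- The guard intervals occurring in a formula. -/
def intervals : FO K P → Set (Term K × Term K)
  | tt => ∅
  | atom _ _ => ∅
  | lt _ _ => ∅
  | conj φ ψ => intervals φ ∪ intervals ψ
  | neg φ => intervals φ
  | ex z φ => guardOf z φ ∪ intervals φ

/-- Hierarchical Interval Formulas (HIFs).  Every `<`-free quantifier-free formula is a HIF;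
HIFs are closed under negation and disjunction (`φ ∨ ψ := ¬(¬φ ∧ ¬ψ)`); and if `φ(x̄, y)` is a
HIF such that the only guard intervals in `φ` involving `y` and a variable free in `φ` are of
the form `(x_l + c_l + c, y + c)` or `(y + c, x_r + c_r + c)` for some `c ∈ K`, then
`∃ y ∈ (x_l + c_l, x_r + c_r). φ` is a HIF. -/
inductive IsHIF : FO K P → Prop
  | base {φ : FO K P} : QFree φ → LtFree φ → IsHIF φ
  | negI {φ : FO K P} : IsHIF φ → IsHIF (neg φ)
  | disjI {φ ψ : FO K P} : IsHIF φ → IsHIF ψ → IsHIF (neg (conj (neg φ) (neg ψ)))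
  | exI {φ : FO K P} {y xl xr : ℕ} {cl cr : K} :
      IsHIF φ → xl ≠ y → xr ≠ y →
      (∀ s t : Term K, (s, t) ∈ intervals φ →
        (s.1 = y → t.1 ≠ y → t.1 ∈ free φ → ∃ c : K, s = (y, c) ∧ t = (xr, cr + c)) ∧
        (t.1 = y → s.1 ≠ y → s.1 ∈ free φ → ∃ c : K, t = (y, c) ∧ s = (xl, cl + c))) →
      IsHIF (guard (xl, cl) (xr, cr) y φ)

/-- A conjunction of constraints of the form `x_j + c < x_k + c'`. -/
def IsConstraintConj : FO K P → Prop
  | tt => True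
  | atom _ _ => False
  | lt _ _ => True
  | conj φ ψ => IsConstraintConj φ ∧ IsConstraintConj ψ
  | neg _ => False
  | ex _ _ => False

/-- The term `t` applies no nonzero shift unless its variable is `x`. -/
def TermOnly (x : ℕ) (t : Term K) : Prop := t.2 = (0 : K) ∨ t.1 = x

/-- The unary functions `+c` are applied only to the variable `x`. -/
def FnOnly (x : ℕ) : FO K P → Prop
  | tt => True
  | atom _ t => TermOnly x t
  | lt s t => TermOnly x s ∧ TermOnly x t
  | conj φ ψ => FnOnly x φ ∧ FnOnly x ψ
  | neg φ => FnOnly x φ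
  | ex _ φ => FnOnly x φ

end FO

/-- Equivalence of two `FO_K` formulas: same truth value for every signal and valuation. -/
def EquivFO (φ ψ : FO K P) : Prop :=
  ∀ (f : ℝ → Set P) (v : ℕ → ℝ), φ.sat f v ↔ ψ.sat f v

/-- An interval `I ⊆ (0,∞)` with endpoints in `K_{≥0} ∪ {∞}` (`hi = none` means `∞`). -/
structure MTLI (K : AddSubgroup ℝ) where
  lo : ℝ
  lo_mem : lo ∈ K
  lo_nonneg : 0 ≤ lo
  loClosed : Bool
  hi : Option ℝ
  hi_mem : ∀ h : ℝ, hi = some h → h ∈ K ∧ 0 ≤ h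
  hiClosed : Bool
  pos : lo = 0 → loClosed = false

namespace MTLI

/-- Membership in the interval. -/
def mem (I : MTLI K) (t : ℝ) : Prop :=
  (if I.loClosed then I.lo ≤ t else I.lo < t) ∧
  ∀ h : ℝ, I.hi = some h → (if I.hiClosed then t ≤ h else t < h)

/-- The interval is bounded. -/
def Bounded (I : MTLI K) : Prop := I.hi ≠ none

/-- The supremum of the interval, in `ℝ ∪ {∞}`. -/
def supW (I : MTLI K) : WithTop ℝ :=
  match I.hi with
  | none => ⊤
  | some h => (h : WithTop ℝ)

/-- The singleton (punctual) interval `{N}`, for `N ∈ K`, `N > 0`. -/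
def single (N : ℝ) (hm : N ∈ K) (h0 : 0 < N) : MTLI K where
  lo := N
  lo_mem := hm
  lo_nonneg := h0.le
  loClosed := true
  hi := some N
  hi_mem := fun h hh => by
    obtain rfl := (Option.some.inj hh).symm
    exact ⟨hm, h0.le⟩
  hiClosed := true
  pos := fun h => absurd h h0.ne'

/-- The unconstrained interval `(0, ∞)`. -/
def full : MTLI K where
  lo := 0
  lo_mem := zero_mem K
  lo_nonneg := le_refl 0
  loClosed := false
  hi := none
  hi_mem := fun _ hh => nomatch hh
  hiClosed := false
  pos := fun _ => rfl

end MTLI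

/-- Formulas of `MTL_K` over atomic propositions `P`. -/
inductive MTL (K : AddSubgroup ℝ) (P : Type) : Type
  | tt : MTL K P
  | atom : P → MTL K P
  | conj : MTL K P → MTL K P → MTL K P
  | neg : MTL K P → MTL K P
  | untl : MTL K P → MTL K P → MTLI K → MTL K P
  | sinc : MTL K P → MTL K P → MTLI K → MTL K P

namespace MTL

/-- Satisfaction of an `MTL_K` formula over a signal, at a point.
`untl φ ψ I` is `φ U_I ψ` and `sinc φ ψ I` is `φ S_I ψ`. -/
def sat (f : ℝ → Set P) : MTL K P → ℝ → Prop
  | tt, _ => True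
  | atom p, r => p ∈ f r
  | conj φ ψ, r => sat f φ r ∧ sat f ψ r
  | neg φ, r => ¬ sat f φ r
  | untl φ ψ I, r =>
      ∃ t : ℝ, r < t ∧ I.mem (t - r) ∧ sat f ψ t ∧ ∀ u, r < u → u < t → sat f φ u
  | sinc φ ψ I, r =>
      ∃ t : ℝ, t < r ∧ I.mem (r - t) ∧ sat f ψ t ∧ ∀ u, t < u → u < r → sat f φ u

/-- All intervals occurring in the temporal operators are bounded. -/
def AllBounded : MTL K P → Prop
  | tt => True
  | atom _ => True
  | conj φ ψ => AllBounded φ ∧ AllBounded ψ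
  | neg φ => AllBounded φ
  | untl φ ψ I => I.Bounded ∧ AllBounded φ ∧ AllBounded ψ
  | sinc φ ψ I => I.Bounded ∧ AllBounded φ ∧ AllBounded ψ

/-- LTL formulas: MTL formulas using only the interval `(0, ∞)`. -/
def IsLTL : MTL K P → Prop
  | tt => True
  | atom _ => True
  | conj φ ψ => IsLTL φ ∧ IsLTL ψ
  | neg φ => IsLTL φ
  | untl φ ψ I => I = MTLI.full ∧ IsLTL φ ∧ IsLTL ψ
  | sinc φ ψ I => I = MTLI.full ∧ IsLTL φ ∧ IsLTL ψ

/-- Future reach. -/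
noncomputable def fr : MTL K P → WithTop ℝ
  | tt => 0
  | atom _ => 0
  | conj φ ψ => max (fr φ) (fr ψ)
  | neg φ => fr φ
  | untl φ ψ I => I.supW + max (fr φ) (fr ψ)
  | sinc φ ψ I => max (fr φ) (WithTop.map (fun x => x - I.lo) (fr ψ))

/-- Past reach. -/
noncomputable def pr : MTL K P → WithTop ℝ
  | tt => 0
  | atom _ => 0
  | conj φ ψ => max (pr φ) (pr ψ)
  | neg φ => pr φ
  | untl φ ψ I => max (pr φ) (WithTop.map (fun x => x - I.lo) (pr ψ))
  | sinc φ ψ I => I.supW + max (pr φ) (pr ψ)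

/-- Boolean combinations of formulas from a class `S`. -/
inductive BC (S : MTL K P → Prop) : MTL K P → Prop
  | base {φ : MTL K P} : S φ → BC S φ
  | negB {φ : MTL K P} : BC S φ → BC S (neg φ)
  | conjB {φ ψ : MTL K P} : BC S φ → BC S ψ → BC S (conj φ ψ)

end MTL

/-- Equivalence of two `MTL_K` formulas. -/
def EquivMTL (φ ψ : MTL K P) : Prop :=
  ∀ (f : ℝ → Set P) (r : ℝ), φ.sat f r ↔ ψ.sat f r

/-- Equivalence of an `FO_K` formula with (at most) free variable `0` and an `MTL_K` formula. -/
def EquivFOMTL (φ : FO K P) (ψ : MTL K P) : Prop :=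
  ∀ (f : ℝ → Set P) (r : ℝ), φ.sat f (fun _ => r) ↔ ψ.sat f r

/-- `MTL_K` and `FO_K` have the same expressive power. -/
def SameExpressive (K : AddSubgroup ℝ) (P : Type) : Prop :=
  (∀ φ : FO K P, φ.free ⊆ {0} → ∃ ψ : MTL K P, EquivFOMTL φ ψ) ∧
  (∀ ψ : MTL K P, ∃ φ : FO K P, φ.free ⊆ {0} ∧ EquivFOMTL φ ψ)

/-- Formulas of `MTL_K` with counting modalities. -/
inductive MTLC (K : AddSubgroup ℝ) (P : Type) : Type
  | tt : MTLC K P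
  | atom : P → MTLC K P
  | conj : MTLC K P → MTLC K P → MTLC K P
  | neg : MTLC K P → MTLC K P
  | untl : MTLC K P → MTLC K P → MTLI K → MTLC K P
  | sinc : MTLC K P → MTLC K P → MTLI K → MTLC K P
  | fcount : ℕ → MTLC K P → MTLC K P
  | pcount : ℕ → MTLC K P → MTLC K P

namespace MTLC

/-- Satisfaction of an `MTL_K+C` formula. -/
def sat (f : ℝ → Set P) : MTLC K P → ℝ → Prop
  | tt, _ => True
  | atom p, r => p ∈ f r
  | conj φ ψ, r => sat f φ r ∧ sat f ψ r
  | neg φ, r => ¬ sat f φ r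
  | untl φ ψ I, r =>
      ∃ t : ℝ, r < t ∧ I.mem (t - r) ∧ sat f ψ t ∧ ∀ u, r < u → u < t → sat f φ u
  | sinc φ ψ I, r =>
      ∃ t : ℝ, t < r ∧ I.mem (r - t) ∧ sat f ψ t ∧ ∀ u, t < u → u < r → sat f φ u
  | fcount n φ, r =>
      ∃ s : Fin n → ℝ, StrictMono s ∧ ∀ i, s i ∈ Set.Ioo r (r + 1) ∧ sat f φ (s i)
  | pcount n φ, r =>
      ∃ s : Fin n → ℝ, StrictMono s ∧ ∀ i, s i ∈ Set.Ioo (r - 1) r ∧ sat f φ (s i)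

end MTLC

/-- The integers, as an additive subgroup of `ℝ`. -/
def intZ : AddSubgroup ℝ := AddSubgroup.zmultiples (1 : ℝ)

/-- Equivalence of an `FO_K` formula with free variable `0` and an `MTL_K+C` formula. -/
def EquivFOMTLC (φ : FO K P) (ψ : MTLC K P) : Prop :=
  ∀ (f : ℝ → Set P) (r : ℝ), φ.sat f (fun _ => r) ↔ ψ.sat f r

/-- Formulas of PQ2MLO: Q2MLO with punctuality. -/
inductive PQ (P : Type) : Type
  | tt : PQ P
  | atom : P → ℕ → PQ P
  | lt : ℕ → ℕ → PQ P
  | conj : PQ P → PQ P → PQ P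
  | neg : PQ P → PQ P
  | ex : ℕ → PQ P → PQ P
  | exFutI : ℕ → ℕ → PQ P → PQ P  -- ∃ y ∈ (x, x+1). ψ
  | exPastI : ℕ → ℕ → PQ P → PQ P -- ∃ y ∈ (x-1, x). ψ
  | exFutP : ℕ → ℕ → PQ P → PQ P  -- ∃ y (y = x+1 ∧ χ)
  | exPastP : ℕ → ℕ → PQ P → PQ P -- ∃ y (y = x-1 ∧ χ)

namespace PQ

/-- Satisfaction of a PQ2MLO formula. -/
def sat (f : ℝ → Set P) : PQ P → (ℕ → ℝ) → Prop
  | tt, _ => True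
  | atom p x, v => p ∈ f (v x)
  | lt x y, v => v x < v y
  | conj φ ψ, v => sat f φ v ∧ sat f ψ v
  | neg φ, v => ¬ sat f φ v
  | ex x φ, v => ∃ r : ℝ, sat f φ (Function.update v x r)
  | exFutI x y ψ, v => ∃ r : ℝ, v x < r ∧ r < v x + 1 ∧ sat f ψ (Function.update v y r)
  | exPastI x y ψ, v => ∃ r : ℝ, v x - 1 < r ∧ r < v x ∧ sat f ψ (Function.update v y r)
  | exFutP x y χ, v => ∃ r : ℝ, r = v x + 1 ∧ sat f χ (Function.update v y r)
  | exPastP x y χ, v => ∃ r : ℝ, r = v x - 1 ∧ sat f χ (Function.update v y r)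

/-- Free variables of a PQ2MLO formula. -/
def free : PQ P → Set ℕ
  | tt => ∅
  | atom _ x => {x}
  | lt x y => {x, y}
  | conj φ ψ => free φ ∪ free ψ
  | neg φ => free φ
  | ex x φ => free φ \ {x}
  | exFutI x y ψ => insert x (free ψ \ {y})
  | exPastI x y ψ => insert x (free ψ \ {y})
  | exFutP x y χ => insert x (free χ \ {y})
  | exPastP x y χ => insert x (free χ \ {y})

/-- Well-formedness: in `∃y∈(x,x+1) ψ` and `∃y∈(x-1,x) ψ` the formula `ψ` has exactly the
free variables `x` and `y`; in `∃y (y = x±1 ∧ χ)` the formula `χ` has exactly the free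
variable `y`. -/
def WF : PQ P → Prop
  | tt => True
  | atom _ _ => True
  | lt _ _ => True
  | conj φ ψ => WF φ ∧ WF ψ
  | neg φ => WF φ
  | ex _ φ => WF φ
  | exFutI x y ψ => x ≠ y ∧ free ψ = {x, y} ∧ WF ψ
  | exPastI x y ψ => x ≠ y ∧ free ψ = {x, y} ∧ WF ψ
  | exFutP x y χ => x ≠ y ∧ free χ = {y} ∧ WF χ
  | exPastP x y χ => x ≠ y ∧ free χ = {y} ∧ WF χ

end PQ

/-- Equivalence of an `FO_ℤ` formula with free variable `0` and a PQ2MLO formula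
with free variable `0`. -/
def EquivFOPQ (φ : FO intZ P) (π : PQ P) : Prop :=
  ∀ (f : ℝ → Set P) (r : ℝ), φ.sat f (fun _ => r) ↔ π.sat f (fun _ => r)

/-- Equivalence of a PQ2MLO formula with free variable `0` and an `MTL_ℤ+C` formula. -/
def EquivPQMTLC (π : PQ P) (ψ : MTLC intZ P) : Prop :=
  ∀ (f : ℝ → Set P) (r : ℝ), π.sat f (fun _ => r) ↔ ψ.sat f r

/-- The singleton interval `{1}` over the integer constants. -/
def oneI : MTLI intZ := MTLI.single 1 (AddSubgroup.mem_zmultiples (1 : ℝ)) one_pos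

/-- The interpretation of the enlarged set of monadic predicates: the predicate `(p, c)`
(i.e. `P^c`) holds at `r` iff `p` holds at `r + c`. -/
def liftSig (K : AddSubgroup ℝ) (f : ℝ → Set P) : ℝ → Set (P × K) :=
  fun r => {pc : P × K | pc.1 ∈ f (r + (pc.2 : ℝ))}

/-- Semantics of a decomposition formula `δ(x,y)`:
`x < y ∧ ∃ z₀ … zₙ (x = z₀ < ⋯ < zₙ = y) ∧ ⋀ φᵢ(zᵢ) ∧ ⋀ ∀u (z_{i-1} < u < z_i → ψᵢ(u))`,
where the `φᵢ`, `ψᵢ` are MTL formulas regarded as unary predicates. -/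
def DecompSat (f : ℝ → Set P) (n : ℕ) (φ ψ : ℕ → MTL K P) (x y : ℝ) : Prop :=
  x < y ∧ ∃ z : ℕ → ℝ, z 0 = x ∧ z n = y ∧ (∀ i < n, z i < z (i + 1)) ∧
    (∀ i, 0 < i → i < n → (φ i).sat f (z i)) ∧
    (∀ i, 0 < i → i ≤ n → ∀ u, z (i - 1) < u → u < z i → (ψ i).sat f u)

/-- Semantics of `δ(x,y)` for abstract unary predicates (no `x < y` conjunct). -/
def Delta (φ ψ : ℕ → ℝ → Prop) (n : ℕ) (x y : ℝ) : Prop :=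
  ∃ z : ℕ → ℝ, z 0 = x ∧ z n = y ∧ (∀ i < n, z i < z (i + 1)) ∧
    (∀ i, 0 < i → i < n → φ i (z i)) ∧
    (∀ i, 0 < i → i ≤ n → ∀ u, z (i - 1) < u → u < z i → ψ i u)

/-- Semantics of `δⱼ(x,y)`: the restriction of `δ` to the first `j` formulas of
`ψ₁, φ₁, ψ₂, φ₂, …, ψₙ`, with `k = ⌈j/2⌉` existential quantifiers after `z₀`. -/
def DeltaJ (φ ψ : ℕ → ℝ → Prop) (j : ℕ) (x y : ℝ) : Prop :=
  ∃ z : ℕ → ℝ, z 0 = x ∧ z ((j + 1) / 2) = y ∧ (∀ i < (j + 1) / 2, z i < z (i + 1)) ∧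
    (∀ i, 0 < i → i ≤ j / 2 → φ i (z i)) ∧
    (∀ i, 0 < i → i ≤ (j + 1) / 2 → ∀ u, z (i - 1) < u → u < z i → ψ i u)

/-- The three kinds of formulas in the separation lemma, for the constant `c`:
`◇_{{N}} θ` with `pr θ < N - c`; `◇⁻_{{N}} θ` with `fr θ < N - c`; and formulas in which
all intervals of temporal operators are bounded. -/
def SepKind (c : ℝ) (χ : MTL K P) : Prop :=
  (∃ (N : ℝ) (hm : N ∈ K) (h0 : 0 < N) (θ : MTL K P),
      χ = MTL.untl MTL.tt θ (MTLI.single N hm h0) ∧ θ.pr < ((N - c : ℝ) : WithTop ℝ)) ∨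
  (∃ (N : ℝ) (hm : N ∈ K) (h0 : 0 < N) (θ : MTL K P),
      χ = MTL.sinc MTL.tt θ (MTLI.single N hm h0) ∧ θ.fr < ((N - c : ℝ) : WithTop ℝ)) ∨
  χ.AllBounded


/-- A property of a signal and a point that is expressed by an `MTL_K` formula. -/
def MTLDefinable (K : AddSubgroup ℝ) {P : Type} (A : (ℝ → Set P) → ℝ → Prop) : Prop :=
  ∃ θ : MTL K P, ∀ f x, A f x ↔ θ.sat f x

namespace MTL

/-- The mirror image of a formula, exchanging future and past. -/
def mirror : MTL K P → MTL K P
  | tt => tt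
  | atom p => atom p
  | conj φ ψ => conj φ.mirror ψ.mirror
  | neg φ => neg φ.mirror
  | untl φ ψ I => sinc φ.mirror ψ.mirror I
  | sinc φ ψ I => untl φ.mirror ψ.mirror I

theorem sat_mirror (f : ℝ → Set P) (θ : MTL K P) :
    ∀ x, θ.mirror.sat f x ↔ θ.sat (fun t => f (-t)) (-x) := by
  induction θ with
  | tt => intro x; simp [mirror, sat]
  | atom p => intro x; simp [mirror, sat]
  | conj φ ψ h₁ h₂ => intro x; simp [mirror, sat, h₁, h₂]
  | neg φ h => intro x; simp [mirror, sat, h]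
  | untl φ ψ I h₁ h₂ =>
    intro x
    simp only [mirror, sat]
    constructor
    · rintro ⟨t, ht, hI, hψ, hφ⟩
      refine ⟨-t, by linarith, by convert hI using 1; ring, (h₂ t).1 hψ, fun u hu hu' => ?_⟩
      have := (h₁ (-u)).1 (hφ (-u) (by linarith) (by linarith))
      rwa [neg_neg] at this
    · rintro ⟨t, ht, hI, hψ, hφ⟩
      refine ⟨-t, by linarith, by convert hI using 1; ring, (h₂ (-t)).2 (by rwa [neg_neg]),
        fun u hu hu' => (h₁ u).2 (hφ (-u) (by linarith) (by linarith))⟩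
  | sinc φ ψ I h₁ h₂ =>
    intro x
    simp only [mirror, sat]
    constructor
    · rintro ⟨t, ht, hI, hψ, hφ⟩
      refine ⟨-t, by linarith, by convert hI using 1; ring, (h₂ t).1 hψ, fun u hu hu' => ?_⟩
      have := (h₁ (-u)).1 (hφ (-u) (by linarith) (by linarith))
      rwa [neg_neg] at this
    · rintro ⟨t, ht, hI, hψ, hφ⟩
      refine ⟨-t, by linarith, by convert hI using 1; ring, (h₂ (-t)).2 (by rwa [neg_neg]),
        fun u hu hu' => (h₁ u).2 (hφ (-u) (by linarith) (by linarith))⟩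

end MTL

/-- The open interval `(0, d)`. -/
def MTLI.openZero (d : ℝ) (hm : d ∈ K) (h0 : 0 < d) : MTLI K where
  lo := 0
  lo_mem := zero_mem K
  lo_nonneg := le_refl 0
  loClosed := false
  hi := some d
  hi_mem := fun h hh => by
    obtain rfl := (Option.some.inj hh).symm
    exact ⟨hm, h0.le⟩
  hiClosed := false
  pos := fun _ => rfl

theorem MTLI.mem_openZero {d : ℝ} (hm : d ∈ K) (h0 : 0 < d) (t : ℝ) :
    (MTLI.openZero d hm h0).mem t ↔ 0 < t ∧ t < d := by
  simp [MTLI.openZero, MTLI.mem]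

theorem MTLI.mem_single {N : ℝ} (hm : N ∈ K) (h0 : 0 < N) (t : ℝ) :
    (MTLI.single N hm h0).mem t ↔ t = N := by
  simp only [MTLI.single, MTLI.mem]
  constructor
  · rintro ⟨h₁, h₂⟩
    have := h₂ N rfl
    simp at h₁ this
    linarith
  · rintro rfl
    simp

namespace MTLDefinable

variable {A B : (ℝ → Set P) → ℝ → Prop}

theorem congr (hA : MTLDefinable K A) (h : ∀ f x, B f x ↔ A f x) : MTLDefinable K B := by
  obtain ⟨θ, hθ⟩ := hA
  exact ⟨θ, fun f x => (h f x).trans (hθ f x)⟩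

theorem true : MTLDefinable K (fun (_ : ℝ → Set P) _ => True) :=
  ⟨.tt, fun _ _ => Iff.rfl⟩

theorem not (hA : MTLDefinable K A) : MTLDefinable K (fun f x => ¬ A f x) := by
  obtain ⟨θ, hθ⟩ := hA
  exact ⟨.neg θ, fun f x => not_congr (hθ f x)⟩

theorem and (hA : MTLDefinable K A) (hB : MTLDefinable K B) :
    MTLDefinable K (fun f x => A f x ∧ B f x) := by
  obtain ⟨θ, hθ⟩ := hA
  obtain ⟨η, hη⟩ := hB
  exact ⟨.conj θ η, fun f x => and_congr (hθ f x) (hη f x)⟩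

theorem or (hA : MTLDefinable K A) (hB : MTLDefinable K B) :
    MTLDefinable K (fun f x => A f x ∨ B f x) :=
  (hA.not.and hB.not).not.congr fun f x => by tauto

theorem exists_mem {ι : Type*} (s : Finset ι) {Q : ι → (ℝ → Set P) → ℝ → Prop}
    (h : ∀ i ∈ s, MTLDefinable K (Q i)) : MTLDefinable K (fun f x => ∃ i ∈ s, Q i f x) := by
  classical
  induction s using Finset.induction_on with
  | empty => exact true.not.congr fun f x => by simp
  | insert i s hi ih =>
    refine ((h i (by simp)).or (ih fun j hj => h j (by simp [hj]))).congr fun f x => ?_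
    simp

theorem mirror (hA : MTLDefinable K A) :
    MTLDefinable K (fun f x => A (fun t => f (-t)) (-x)) := by
  obtain ⟨θ, hθ⟩ := hA
  exact ⟨θ.mirror, fun f x => (hθ _ _).trans (θ.sat_mirror f x).symm⟩

theorem shift (hA : MTLDefinable K A) {k : ℝ} (hk : k ∈ K) :
    MTLDefinable K (fun f x => A f (x + k)) := by
  obtain ⟨θ, hθ⟩ := hA
  rcases lt_trichotomy k 0 with h | rfl | h
  · refine ⟨.sinc .tt θ (.single (-k) (neg_mem hk) (by linarith)), fun f x => ?_⟩
    simp only [MTL.sat, MTLI.mem_single, hθ]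
    constructor
    · exact fun hs => ⟨x + k, by linarith, by ring, hs, fun _ _ _ => trivial⟩
    · rintro ⟨t, -, ht, hs, -⟩
      obtain rfl : t = x + k := by linarith
      exact hs
  · exact ⟨θ, fun f x => by simp [hθ]⟩
  · refine ⟨.untl .tt θ (.single k hk h), fun f x => ?_⟩
    simp only [MTL.sat, MTLI.mem_single, hθ]
    constructor
    · exact fun hs => ⟨x + k, by linarith, by ring, hs, fun _ _ _ => trivial⟩
    · rintro ⟨t, -, ht, hs, -⟩
      obtain rfl : t = x + k := by linarith
      exact hs

theorem untl (hA : MTLDefinable K A) (hB : MTLDefinable K B) {d : ℝ} (hd : d ∈ K) (h0 : 0 < d) :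
    MTLDefinable K
      (fun f x => ∃ t, x < t ∧ t < x + d ∧ (∀ u, x < u → u < t → A f u) ∧ B f t) := by
  obtain ⟨θ, hθ⟩ := hA
  obtain ⟨η, hη⟩ := hB
  refine ⟨.untl θ η (.openZero d hd h0), fun f x => ?_⟩
  simp only [MTL.sat, MTLI.mem_openZero, hθ, hη]
  refine exists_congr fun t => ?_
  constructor
  · rintro ⟨h₁, h₂, h₃, h₄⟩
    exact ⟨h₁, ⟨by linarith, by linarith⟩, h₄, h₃⟩
  · rintro ⟨h₁, ⟨h₂, h₂'⟩, h₃, h₄⟩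
    exact ⟨h₁, by linarith, h₄, h₃⟩

theorem always (hA : MTLDefinable K A) {d : ℝ} (hd : d ∈ K) (h0 : 0 < d) :
    MTLDefinable K (fun f x => ∀ u, x < u → u < x + d → A f u) := by
  refine (true.untl hA.not hd h0).not.congr fun f x => ?_
  push Not
  simp only [implies_true, forall_const]

theorem always_Ioc (hA : MTLDefinable K A) {d : ℝ} (hd : d ∈ K) (h0 : 0 ≤ d) :
    MTLDefinable K (fun f x => ∀ u, x < u → u ≤ x + d → A f u) := by
  rcases h0.eq_or_lt with rfl | h0
  · exact true.congr fun f x => ⟨fun _ => trivial, fun _ u h₁ h₂ => by linarith⟩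
  · refine ((hA.always hd h0).and (hA.shift hd)).congr fun f x => ⟨fun h => ?_, ?_⟩
    · exact ⟨fun u h₁ h₂ => h u h₁ h₂.le, h _ (by linarith) le_rfl⟩
    · rintro ⟨h₁, h₂⟩ u hu hu'
      rcases hu'.eq_or_lt with rfl | hu'
      exacts [h₂, h₁ u hu hu']

theorem always_Ico (hA : MTLDefinable K A) {a b : ℝ} (ha : a ∈ K) (hb : b ∈ K) (hab : a < b) :
    MTLDefinable K (fun f x => ∀ u, x + a ≤ u → u < x + b → A f u) := by
  refine ((hA.and (hA.always (sub_mem hb ha) (sub_pos.2 hab))).shift ha).congr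
    fun f x => ⟨fun h => ?_, ?_⟩
  · exact ⟨h _ le_rfl (by linarith), fun u h₁ h₂ => h u h₁.le (by linarith)⟩
  · rintro ⟨h₁, h₂⟩ u hu hu'
    rcases hu.eq_or_lt with rfl | hu
    exacts [h₁, h₂ u hu (by linarith)]

end MTLDefinable

/-- There are points `x < z₀ < ⋯ < z_{n-1} < y` such that `φ i` holds at `zᵢ` and
`ψ 0, …, ψ n` hold on the successive open intervals between these points. -/
def Chain : ℕ → (ℕ → ℝ → Prop) → (ℕ → ℝ → Prop) → ℝ → ℝ → Prop
  | 0, _, ψ, x, y => x < y ∧ ∀ u, x < u → u < y → ψ 0 u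
  | n + 1, φ, ψ, x, y => ∃ z, x < z ∧ z < y ∧ (∀ u, x < u → u < z → ψ 0 u) ∧ φ 0 z ∧
      Chain n (fun i => φ (i + 1)) (fun i => ψ (i + 1)) z y

namespace Chain

theorem lt {n : ℕ} {φ ψ : ℕ → ℝ → Prop} {x y : ℝ} (h : Chain n φ ψ x y) : x < y := by
  cases n with
  | zero => exact h.1
  | succ n => obtain ⟨z, h₁, h₂, -⟩ := h; exact h₁.trans h₂

theorem mono {n : ℕ} : ∀ {φ ψ φ' ψ' : ℕ → ℝ → Prop} {x y : ℝ},
    (∀ i < n, ∀ u, x < u → u < y → φ i u → φ' i u) → (∀ i ≤ n, ∀ u, ψ i u → ψ' i u) →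
    Chain n φ ψ x y → Chain n φ' ψ' x y := by
  induction n with
  | zero =>
    intro φ ψ φ' ψ' x y _ hψ h
    exact ⟨h.1, fun u h₁ h₂ => hψ 0 le_rfl u (h.2 u h₁ h₂)⟩
  | succ n ih =>
    rintro φ ψ φ' ψ' x y hφ hψ ⟨z, h₁, h₂, h₃, h₄, h₅⟩
    refine ⟨z, h₁, h₂, fun u hu hu' => hψ 0 (by omega) u (h₃ u hu hu'),
      hφ 0 (by omega) z h₁ h₂ h₄, ih ?_ ?_ h₅⟩
    · exact fun i hi u hu hu' => hφ (i + 1) (by omega) u (h₁.trans hu) hu'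
    · exact fun i hi u => hψ (i + 1) (by omega) u

theorem glue {k : ℕ} : ∀ {j : ℕ} {φ ψ : ℕ → ℝ → Prop} {x m y : ℝ},
    Chain j φ ψ x m → φ j m →
    Chain k (fun i => φ (j + 1 + i)) (fun i => ψ (j + 1 + i)) m y →
    Chain (j + k + 1) φ ψ x y := by
  intro j
  induction j with
  | zero =>
    intro φ ψ x m y h₁ h₂ h₃
    rw [Nat.zero_add]
    refine ⟨m, h₁.1, h₃.lt, h₁.2, h₂, ?_⟩
    simpa only [Nat.zero_add, Nat.add_comm 1] using h₃
  | succ j ih =>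
    rintro φ ψ x m y ⟨z, hz, hz', h₁, h₂, h₃⟩ h₄ h₅
    rw [show j + 1 + k + 1 = (j + k + 1) + 1 by omega]
    refine ⟨z, hz, hz'.trans h₅.lt, h₁, h₂, ih h₃ h₄ ?_⟩
    have e : ∀ i, j + 1 + 1 + i = j + 1 + i + 1 := by omega
    simpa only [e] using h₅

theorem glue_gap {k : ℕ} : ∀ {j : ℕ} {φ ψ : ℕ → ℝ → Prop} {x m y : ℝ},
    Chain j φ ψ x m → ψ j m → Chain k (fun i => φ (j + i)) (fun i => ψ (j + i)) m y →
    Chain (j + k) φ ψ x y := by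
  intro j
  induction j with
  | zero =>
    intro φ ψ x m y h₁ h₂ h₃
    simp only [Nat.zero_add] at h₃ ⊢
    have key : ∀ z, (∀ u, m < u → u < z → ψ 0 u) → ∀ u, x < u → u < z → ψ 0 u := by
      intro z hz u hu hu'
      rcases lt_trichotomy u m with h | rfl | h
      exacts [h₁.2 u hu h, h₂, hz u h hu']
    cases k with
    | zero => exact ⟨h₁.1.trans h₃.1, key y h₃.2⟩
    | succ k =>
      obtain ⟨z, hz, hz', h₄, h₅⟩ := h₃
      exact ⟨z, h₁.1.trans hz, hz', key z h₄, h₅⟩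
  | succ j ih =>
    rintro φ ψ x m y ⟨z, hz, hz', h₁, h₂, h₃⟩ h₄ h₅
    rw [show j + 1 + k = (j + k) + 1 by omega]
    refine ⟨z, hz, hz'.trans h₅.lt, h₁, h₂, ih h₃ h₄ ?_⟩
    have e : ∀ i, j + 1 + i = j + i + 1 := by omega
    simpa only [e] using h₅

theorem split {n : ℕ} : ∀ {φ ψ : ℕ → ℝ → Prop} {x y : ℝ}, Chain n φ ψ x y →
    ∀ m, x < m → m < y →
    (∃ j k, j + k + 1 = n ∧ Chain j φ ψ x m ∧ φ j m ∧
      Chain k (fun i => φ (j + 1 + i)) (fun i => ψ (j + 1 + i)) m y) ∨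
    (∃ j k, j + k = n ∧ Chain j φ ψ x m ∧ ψ j m ∧
      Chain k (fun i => φ (j + i)) (fun i => ψ (j + i)) m y) := by
  induction n with
  | zero =>
    intro φ ψ x y h m hm hm'
    refine Or.inr ⟨0, 0, rfl, ⟨hm, fun u h₁ h₂ => h.2 u h₁ (h₂.trans hm')⟩, h.2 m hm hm',
      ⟨hm', fun u h₁ h₂ => h.2 u (hm.trans h₁) h₂⟩⟩
  | succ n ih =>
    rintro φ ψ x y ⟨z, hz, hz', h₁, h₂, h₃⟩ m hm hm'
    rcases lt_trichotomy z m with h | rfl | h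
    · rcases ih h₃ m h hm' with ⟨j, k, hjk, g₁, g₂, g₃⟩ | ⟨j, k, hjk, g₁, g₂, g₃⟩
      · refine Or.inl ⟨j + 1, k, by omega, ⟨z, hz, h, h₁, h₂, g₁⟩, g₂, ?_⟩
        have e : ∀ i, j + 1 + 1 + i = j + 1 + i + 1 := by omega
        simpa only [e] using g₃
      · refine Or.inr ⟨j + 1, k, by omega, ⟨z, hz, h, h₁, h₂, g₁⟩, g₂, ?_⟩
        have e : ∀ i, j + 1 + i = j + i + 1 := by omega
        simpa only [e] using g₃
    · refine Or.inl ⟨0, n, by omega, ⟨hz, h₁⟩, h₂, ?_⟩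
      simpa only [Nat.zero_add, Nat.add_comm 1] using h₃
    · refine Or.inr ⟨0, n + 1, by omega, ⟨hm, fun u g g' => h₁ u g (g'.trans h)⟩,
        h₁ m hm h, ⟨z, h, hz', fun u g g' => ?_, ?_⟩⟩
      · simpa using h₁ u (hm.trans g) g'
      · simpa only [Nat.zero_add] using And.intro h₂ h₃

theorem neg {n : ℕ} : ∀ {φ ψ : ℕ → ℝ → Prop} {x y : ℝ}, Chain n φ ψ x y →
    Chain n (fun i t => φ (n - 1 - i) (-t)) (fun i t => ψ (n - i) (-t)) (-y) (-x) := by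
  induction n with
  | zero =>
    intro φ ψ x y h
    exact ⟨neg_lt_neg h.1, fun u h₁ h₂ => h.2 (-u) (by linarith) (by linarith)⟩
  | succ n ih =>
    rintro φ ψ x y ⟨z, hz, hz', h₁, h₂, h₃⟩
    refine glue (j := n) (k := 0) (m := -z) (mono ?_ ?_ (ih h₃)) ?_ ?_
    · intro i hi u _ _ hu
      rwa [show n + 1 - 1 - i = n - 1 - i + 1 by omega]
    · intro i hi u hu
      rwa [show n + 1 - i = n - i + 1 by omega]
    · simpa using h₂
    · refine ⟨neg_lt_neg hz, fun u g g' => ?_⟩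
      have := h₁ (-u) (by linarith) (by linarith)
      simpa using this

theorem neg_iff {n : ℕ} {φ ψ : ℕ → ℝ → Prop} {x y : ℝ} :
    Chain n (fun i t => φ (n - 1 - i) (-t)) (fun i t => ψ (n - i) (-t)) (-y) (-x) ↔
      Chain n φ ψ x y := by
  refine ⟨fun h => ?_, neg⟩
  have := h.neg
  rw [neg_neg, neg_neg] at this
  refine mono ?_ ?_ this
  · intro i hi u _ _ hu
    rwa [neg_neg, show n - 1 - (n - 1 - i) = i by omega] at hu
  · intro i hi u hu
    rwa [neg_neg, show n - (n - i) = i by omega] at hu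

theorem extend_left {n : ℕ} {φ ψ : ℕ → ℝ → Prop} {x p y : ℝ} (hxp : x ≤ p)
    (h : ∀ u, x < u → u ≤ p → ψ 0 u) (hc : Chain n φ ψ p y) : Chain n φ ψ x y := by
  rcases hxp.eq_or_lt with rfl | hxp
  · exact hc
  · have := glue_gap (j := 0) (k := n) (φ := φ) (ψ := ψ) (x := x) (m := p) (y := y)
      ⟨hxp, fun u h₁ h₂ => h u h₁ h₂.le⟩ (h p hxp le_rfl)
      (by simpa only [Nat.zero_add] using hc)
    rwa [Nat.zero_add] at this

theorem last {n : ℕ} : ∀ {φ ψ : ℕ → ℝ → Prop} {x q y : ℝ}, x < q →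
    Chain n (fun i t => φ i t ∧ t < q) ψ x y → ∀ u, q ≤ u → u < y → ψ n u := by
  induction n with
  | zero => intro φ ψ x q y hq h u h₁ h₂; exact h.2 u (hq.trans_le h₁) h₂
  | succ n ih =>
    rintro φ ψ x q y hq ⟨z, hz, hz', h₁, ⟨h₂, h₂'⟩, h₃⟩ u hu hu'
    exact ih (ψ := fun i => ψ (i + 1)) h₂' h₃ u hu hu'

end Chain

/-- Nested until formulas with bound `d`, ending with `ψ n` holding for `e` time units. -/
def NestedUntil (d e : ℝ) : ℕ → (ℕ → ℝ → Prop) → (ℕ → ℝ → Prop) → ℝ → Prop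
  | 0, _, ψ, x => ∀ u, x < u → u < x + e → ψ 0 u
  | n + 1, φ, ψ, x => ∃ z, x < z ∧ z < x + d ∧ (∀ u, x < u → u < z → ψ 0 u) ∧ φ 0 z ∧
      NestedUntil d e n (fun i => φ (i + 1)) (fun i => ψ (i + 1)) z

theorem NestedUntil.definable {d e : ℝ} (hd : d ∈ K) (hd0 : 0 < d) (he : e ∈ K) (he0 : 0 < e)
    {n : ℕ} : ∀ {φ ψ : ℕ → (ℝ → Set P) → ℝ → Prop},
    (∀ i, MTLDefinable K (φ i)) → (∀ i, MTLDefinable K (ψ i)) →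
    MTLDefinable K (fun f x => NestedUntil d e n (fun i => φ i f) (fun i => ψ i f) x) := by
  induction n with
  | zero => intro φ ψ hφ hψ; exact (hψ 0).always he he0
  | succ n ih =>
    intro φ ψ hφ hψ
    exact (hψ 0).untl ((hφ 0).and (ih (fun i => hφ (i + 1)) fun i => hψ (i + 1))) hd hd0

theorem Chain.nestedUntil {d e : ℝ} {n : ℕ} : ∀ {φ ψ : ℕ → ℝ → Prop} {p q x y : ℝ},
    Chain n (fun i t => φ i t ∧ t < q) ψ x y → p ≤ x → x < q → q ≤ p + d → q + e ≤ y →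
    NestedUntil d e n φ ψ x := by
  induction n with
  | zero =>
    intro φ ψ p q x y h hp hq hd he u h₁ h₂
    exact h.2 u h₁ (by linarith)
  | succ n ih =>
    rintro φ ψ p q x y ⟨z, hz, hz', h₁, ⟨h₂, h₂'⟩, h₃⟩ hp hq hd he
    exact ⟨z, hz, by linarith, h₁, h₂, ih h₃ (hp.trans hz.le) h₂' hd he⟩

theorem NestedUntil.chain {d e : ℝ} (hd : 0 ≤ d) {n : ℕ} :
    ∀ {φ ψ : ℕ → ℝ → Prop} {p q x y : ℝ},
    NestedUntil d e n φ ψ x → p ≤ x → x < y → q ≤ p + e → x + n * d ≤ y →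
    (∀ u, q ≤ u → u < y → ψ n u) → Chain n φ ψ x y := by
  induction n with
  | zero =>
    intro φ ψ p q x y h hp hxy hq _ hψ
    refine ⟨hxy, fun u h₁ h₂ => ?_⟩
    rcases le_or_gt q u with hu | hu
    exacts [hψ u hu h₂, h u h₁ (by linarith)]
  | succ n ih =>
    rintro φ ψ p q x y ⟨z, hz, hz', h₁, h₂, h₃⟩ hp hxy hq hn hψ
    push_cast at hn
    have hnd : 0 ≤ n * d := by positivity
    have hzy : z < y := by linarith
    exact ⟨z, hz, hzy, h₁, h₂, ih h₃ (hp.trans hz.le) hzy hq (by linarith) hψ⟩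

/-- Some definable property lies between "there is a chain from `x` to `x + c` with all interior
points in `(x + a, x + b)`" and "there is a chain from `x` to `x + c`". -/
def Interpolable (K : AddSubgroup ℝ) (c : ℝ) (n : ℕ) (φ ψ : ℕ → (ℝ → Set P) → ℝ → Prop)
    (a b : ℝ) : Prop :=
  ∃ A : (ℝ → Set P) → ℝ → Prop, MTLDefinable K A ∧ ∀ f x,
    (Chain n (fun i t => φ i f t ∧ x + a < t ∧ t < x + b) (fun i => ψ i f) x (x + c) → A f x) ∧
    (A f x → Chain n (fun i => φ i f) (fun i => ψ i f) x (x + c))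

namespace Interpolable

variable {c : ℝ} {n : ℕ} {φ ψ : ℕ → (ℝ → Set P) → ℝ → Prop} {a b : ℝ}

theorem of_small_left (hc : c ∈ K) (hφ : ∀ i, MTLDefinable K (φ i))
    (hψ : ∀ i, MTLDefinable K (ψ i)) (ha : a ∈ K) (hb : b ∈ K) (ha0 : 0 ≤ a) (hab : a < b)
    (h2 : 2 * (b - a) ≤ c - a) (hn : (n + 1) * (b - a) ≤ c - a) :
    Interpolable K c (n + 1) φ ψ a b := by
  have hbc : b < c := by linarith
  refine ⟨_, ((hψ 0).always_Ioc ha ha0).and (((NestedUntil.definable (n := n + 1)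
    (sub_mem hb ha) (sub_pos.2 hab) (sub_mem hc hb) (sub_pos.2 hbc) hφ hψ).shift ha).and
    ((hψ (n + 1)).always_Ico hb hc hbc)), fun f x => ⟨?_, ?_⟩⟩
  · intro h
    have h' : Chain (n + 1) (fun i t => φ i f t ∧ t < x + b) (fun i => ψ i f) (x + a) (x + c) := by
      obtain ⟨z, hz, hz', h₁, ⟨h₂, h₂', h₂''⟩, h₃⟩ := h
      exact ⟨z, h₂', hz', fun u g g' => h₁ u (by linarith) g', ⟨h₂, h₂''⟩,
        h₃.mono (fun i _ u _ _ hu => ⟨hu.1, hu.2.2⟩) fun _ _ _ => id⟩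
    refine ⟨?_, h'.nestedUntil le_rfl (by linarith) (by linarith) (by linarith),
      Chain.last (by linarith) h'⟩
    obtain ⟨z, hz, hz', h₁, ⟨h₂, h₂', h₂''⟩, h₃⟩ := h
    exact fun u g g' => h₁ u g (by linarith)
  · rintro ⟨h₁, h₂, h₃⟩
    refine Chain.extend_left (by linarith) h₁ (h₂.chain (by linarith) le_rfl (by linarith)
      (q := x + b) (by linarith) ?_ h₃)
    push_cast
    linarith

theorem of_mirror (hc : c ∈ K)
    (h : Interpolable K c n (fun i f t => φ (n - 1 - i) (fun s => f (-s)) (-t))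
      (fun i f t => ψ (n - i) (fun s => f (-s)) (-t)) (c - b) (c - a)) :
    Interpolable K c n φ ψ a b := by
  obtain ⟨A, hA, h⟩ := h
  refine ⟨_, hA.mirror.shift hc, fun f x => ?_⟩
  obtain ⟨h₁, h₂⟩ := h (fun t => f (-t)) (-(x + c))
  simp only [neg_neg] at h₁ h₂
  have hx : -(x + c) + c = -x := by ring
  rw [hx] at h₁ h₂
  refine ⟨fun g => h₁ (g.neg.mono ?_ fun _ _ _ => id), fun g => Chain.neg_iff.1 (h₂ g)⟩
  rintro i - u - - ⟨g₁, g₂, g₃⟩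
  exact ⟨g₁, by linarith, by linarith⟩

theorem of_small (hc : c ∈ K) (hφ : ∀ i, MTLDefinable K (φ i))
    (hψ : ∀ i, MTLDefinable K (ψ i)) (ha : a ∈ K) (hb : b ∈ K) (ha0 : 0 ≤ a) (hab : a < b)
    (hbc : b ≤ c) (hn : 4 * (n + 1) * (b - a) ≤ c) :
    Interpolable K c (n + 1) φ ψ a b := by
  have hnn : 0 ≤ n * (b - a) := mul_nonneg n.cast_nonneg (by linarith)
  rcases le_total (a + b) c with h | h
  · exact of_small_left hc hφ hψ ha hb ha0 hab (by linarith) (by linarith)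
  · refine of_mirror hc (of_small_left hc (fun i => (hφ _).mirror) (fun i => (hψ _).mirror)
      (sub_mem hc hb) (sub_mem hc ha) (by linarith) (by linarith) (by linarith) (by linarith))

theorem union {m : ℝ} (hc : c ∈ K) (hm : m ∈ K) (hm0 : 0 < m) (hmc : m < c)
    (ih : ∀ j < n, ∀ c ∈ K, 0 < c → ∀ φ ψ : ℕ → (ℝ → Set P) → ℝ → Prop,
      (∀ i, MTLDefinable K (φ i)) → (∀ i, MTLDefinable K (ψ i)) →
      MTLDefinable K (fun f x => Chain j (fun i => φ i f) (fun i => ψ i f) x (x + c)))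
    (hφ : ∀ i, MTLDefinable K (φ i)) (hψ : ∀ i, MTLDefinable K (ψ i))
    (h₁ : Interpolable K c n φ ψ a m) (h₂ : Interpolable K c n φ ψ m b) :
    Interpolable K c n φ ψ a b := by
  obtain ⟨A₁, hA₁, h₁⟩ := h₁
  obtain ⟨A₂, hA₂, h₂⟩ := h₂
  have exact_def : MTLDefinable K (fun f x =>
      ∃ r ∈ (Finset.range n ×ˢ Finset.range n).filter (fun r : ℕ × ℕ => r.1 + r.2 + 1 = n),
        Chain r.1 (fun i => φ i f) (fun i => ψ i f) x (x + m) ∧ φ r.1 f (x + m) ∧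
        Chain r.2 (fun i => φ (r.1 + 1 + i) f) (fun i => ψ (r.1 + 1 + i) f) (x + m)
          (x + m + (c - m))) := by
    refine MTLDefinable.exists_mem _ fun r hr => ?_
    simp only [Finset.mem_filter, Finset.mem_product, Finset.mem_range] at hr
    exact (ih r.1 hr.1.1 m hm hm0 φ ψ hφ hψ).and (((hφ r.1).shift hm).and
      ((ih r.2 hr.1.2 (c - m) (sub_mem hc hm) (sub_pos.2 hmc) _ _ (fun i => hφ _)
        (fun i => hψ _)).shift hm))
  have gap_def : MTLDefinable K (fun f x =>
      ∃ r ∈ (Finset.range n ×ˢ Finset.range n).filter (fun r : ℕ × ℕ => r.1 + r.2 = n),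
        Chain r.1 (fun i => φ i f) (fun i => ψ i f) x (x + m) ∧ ψ r.1 f (x + m) ∧
        Chain r.2 (fun i => φ (r.1 + i) f) (fun i => ψ (r.1 + i) f) (x + m)
          (x + m + (c - m))) := by
    refine MTLDefinable.exists_mem _ fun r hr => ?_
    simp only [Finset.mem_filter, Finset.mem_product, Finset.mem_range] at hr
    exact (ih r.1 hr.1.1 m hm hm0 φ ψ hφ hψ).and (((hψ r.1).shift hm).and
      ((ih r.2 hr.1.2 (c - m) (sub_mem hc hm) (sub_pos.2 hmc) _ _ (fun i => hφ _)
        (fun i => hψ _)).shift hm))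
  refine ⟨_, (hA₁.or hA₂).or (exact_def.or gap_def), fun f x => ?_⟩
  have hend : x + m + (c - m) = x + c := by ring
  simp only [hend, Finset.mem_filter, Finset.mem_product, Finset.mem_range]
  constructor
  · intro h
    rcases h.split (x + m) (by linarith) (by linarith) with
      ⟨j, k, hjk, g₁, g₂, g₃⟩ | ⟨j, k, hjk, g₁, g₂, g₃⟩
    · exact Or.inr (Or.inl ⟨(j, k), ⟨⟨by simp; omega, by simp; omega⟩, hjk⟩,
        g₁.mono (fun _ _ _ _ _ hu => hu.1) (fun _ _ _ => id), g₂.1,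
        g₃.mono (fun _ _ _ _ _ hu => hu.1) (fun _ _ _ => id)⟩)
    · rcases Nat.eq_zero_or_pos j with rfl | hj
      · obtain rfl : k = n := by omega
        refine Or.inl (Or.inr ((h₂ f x).1 ?_))
        simp only [Nat.zero_add] at g₃
        refine Chain.extend_left (p := x + m) (by linarith) ?_
          (g₃.mono (fun i _ u hu _ hu' => ⟨hu'.1, hu, hu'.2.2⟩) fun _ _ _ => id)
        intro u hu hu'
        rcases hu'.eq_or_lt with rfl | hu'
        exacts [g₂, g₁.2 u hu hu']
      · rcases Nat.eq_zero_or_pos k with rfl | hk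
        · obtain rfl : j = n := by omega
          refine Or.inl (Or.inl ((h₁ f x).1 ?_))
          refine Chain.glue_gap (k := 0) (m := x + m)
            (g₁.mono (fun i _ u _ hu hu' => ⟨hu'.1, hu'.2.1, hu⟩) fun _ _ _ => id) g₂ g₃
        · exact Or.inr (Or.inr ⟨(j, k), ⟨⟨by simp; omega, by simp; omega⟩, hjk⟩,
            g₁.mono (fun _ _ _ _ _ hu => hu.1) (fun _ _ _ => id), g₂,
            g₃.mono (fun _ _ _ _ _ hu => hu.1) (fun _ _ _ => id)⟩)
  · rintro ((h | h) | ⟨r, ⟨-, hr⟩, g₁, g₂, g₃⟩ | ⟨r, ⟨-, hr⟩, g₁, g₂, g₃⟩)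
    · exact (h₁ f x).2 h
    · exact (h₂ f x).2 h
    · exact hr ▸ Chain.glue (φ := fun i => φ i f) (ψ := fun i => ψ i f) g₁ g₂ g₃
    · exact hr ▸ Chain.glue_gap (φ := fun i => φ i f) (ψ := fun i => ψ i f) g₁ g₂ g₃

end Interpolable

theorem DenseK.exists_small (hK : DenseK K) {c : ℝ} (hc : c ∈ K) (hc0 : 0 < c) (N : ℕ) :
    ∃ d ∈ K, 0 < d ∧ N * d ≤ c := by
  induction N with
  | zero => exact ⟨c, hc, hc0, by simpa using hc0.le⟩
  | succ N ih =>
    obtain ⟨d, hd, hd0, hN⟩ := ih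
    obtain ⟨e, he, he0, hed⟩ := hK 0 (zero_mem K) d hd hd0
    have hmin : ∃ g ∈ K, 0 < g ∧ 2 * g ≤ d := by
      rcases le_total (2 * e) d with h | h
      · exact ⟨e, he, he0, h⟩
      · exact ⟨d - e, sub_mem hd he, by linarith, by linarith⟩
    obtain ⟨g, hg, hg0, hgd⟩ := hmin
    rcases Nat.eq_zero_or_pos N with rfl | hpos
    · exact ⟨c, hc, hc0, by simp⟩
    · refine ⟨g, hg, hg0, ?_⟩
      have h1 : (1 : ℝ) ≤ N := by exact_mod_cast hpos
      push_cast
      nlinarith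

theorem Chain.definable (hK : DenseK K) (n : ℕ) : ∀ c ∈ K, 0 < c →
    ∀ φ ψ : ℕ → (ℝ → Set P) → ℝ → Prop,
    (∀ i, MTLDefinable K (φ i)) → (∀ i, MTLDefinable K (ψ i)) →
    MTLDefinable K (fun f x => Chain n (fun i => φ i f) (fun i => ψ i f) x (x + c)) := by
  induction n using Nat.strong_induction_on with
  | _ n ih =>
  intro c hc hc0 φ ψ hφ hψ
  cases n with
  | zero =>
    refine ((hψ 0).always hc hc0).congr fun f x => ⟨fun h => h.2, fun h => ⟨by linarith, h⟩⟩
  | succ n =>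
    obtain ⟨d, hd, hd0, hdc⟩ := hK.exists_small hc hc0 (4 * (n + 1))
    push_cast at hdc
    have key : ∀ k : ℕ, ∀ a ∈ K, ∀ b ∈ K, 0 ≤ a → a < b → b ≤ c → b - a ≤ (k + 1) * d →
        Interpolable K c (n + 1) φ ψ a b := by
      have small : ∀ a ∈ K, ∀ b ∈ K, 0 ≤ a → a < b → b ≤ c → b - a ≤ d →
          Interpolable K c (n + 1) φ ψ a b := fun a ha b hb ha0 hab hbc h =>
        .of_small hc hφ hψ ha hb ha0 hab hbc
          ((mul_le_mul_of_nonneg_left h (by positivity)).trans hdc)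
      intro k
      induction k with
      | zero =>
        exact fun a ha b hb ha0 hab hbc h =>
          small a ha b hb ha0 hab hbc (by simpa using h)
      | succ k ihk =>
        intro a ha b hb ha0 hab hbc h
        rcases le_or_gt (b - a) d with hs | hs
        · exact small a ha b hb ha0 hab hbc hs
        · have had := add_mem ha hd
          push_cast at h
          exact .union hc had (by linarith) (by linarith) ih hφ hψ
            (small a ha _ had ha0 (by linarith) (by linarith) (by linarith))
            (ihk _ had b hb (by linarith) (by linarith) hbc (by linarith))
    obtain ⟨k, hk⟩ := exists_nat_ge (c / d)
    obtain ⟨A, hA, h⟩ := key k 0 (zero_mem K) c hc le_rfl hc0 le_rfl (by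
      rw [div_le_iff₀ hd0] at hk
      linarith)
    refine hA.congr fun f x => ⟨fun g => (h f x).1 (g.mono ?_ fun _ _ _ => id), (h f x).2⟩
    exact fun i _ u h₁ h₂ hu => ⟨hu, by linarith, h₂⟩

theorem delta_iff_chain {n : ℕ} : ∀ {φ ψ : ℕ → ℝ → Prop} {x y : ℝ},
    Delta φ ψ (n + 1) x y ↔ Chain n (fun i => φ (i + 1)) (fun i => ψ (i + 1)) x y := by
  induction n with
  | zero =>
    intro φ ψ x y
    constructor
    · rintro ⟨z, rfl, rfl, h₁, -, h₃⟩
      exact ⟨h₁ 0 one_pos, h₃ 1 one_pos le_rfl⟩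
    · rintro ⟨h₁, h₂⟩
      refine ⟨fun i => if i = 0 then x else y, rfl, rfl, ?_, by omega, ?_⟩
      · intro i hi
        obtain rfl : i = 0 := by omega
        simpa using h₁
      · intro i hi hi'
        obtain rfl : i = 1 := by omega
        simpa using h₂
  | succ n ih =>
    intro φ ψ x y
    constructor
    · rintro ⟨z, rfl, rfl, h₁, h₂, h₃⟩
      have h : Chain n (fun i => φ (i + 1 + 1)) (fun i => ψ (i + 1 + 1)) (z 1) (z (n + 1 + 1)) := by
        refine ih (φ := fun i => φ (i + 1)) (ψ := fun i => ψ (i + 1)).1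
          ⟨fun i => z (i + 1), rfl, rfl, fun i hi => h₁ (i + 1) (by omega),
            fun i hi hi' => h₂ (i + 1) (by omega) (by omega), fun i hi hi' u hu hu' => ?_⟩
        refine h₃ (i + 1) (by omega) (by omega) u ?_ hu'
        rwa [show i + 1 - 1 = i - 1 + 1 by omega]
      exact ⟨z 1, h₁ 0 (by omega), h.lt, h₃ 1 (by omega) (by omega),
        h₂ 1 (by omega) (by omega), h⟩
    · rintro ⟨w, hw, hw', h₁, h₂, h₃⟩
      obtain ⟨z, rfl, rfl, g₁, g₂, g₃⟩ :=
        ih (φ := fun i => φ (i + 1)) (ψ := fun i => ψ (i + 1)).2 h₃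
      refine ⟨fun i => Nat.casesOn i x z, rfl, rfl, ?_, ?_, ?_⟩
      · rintro (_ | i) hi
        exacts [hw, g₁ i (by omega)]
      · rintro (_ | _ | i) hi hi'
        exacts [absurd hi (by omega), h₂, g₂ (i + 1) (by omega) (by omega)]
      · rintro (_ | _ | i) hi hi'
        exacts [absurd hi (by omega), h₁, g₃ (i + 1) (by omega) (by omega)]

/-- **Lemma 5.** Let `K` be a dense, nontrivial additive subgroup of `ℝ` and `c ∈ K`,
`c > 0`.  Any decomposition formula `δ(x, x+c)` is equivalent to an `MTL_K` formula. -/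
theorem decomposition_equiv_mtl (K : AddSubgroup ℝ) (hdense : DenseK K) (hnt : K ≠ ⊥)
    (c : K) (hc : 0 < (c : ℝ)) (n : ℕ) (φ ψ : ℕ → MTL K ℕ)
    (hφ : ∀ i, 0 < i → i < n → (φ i).IsLTL) (hψ : ∀ i, 0 < i → i ≤ n → (ψ i).IsLTL) :
    ∃ θ : MTL K ℕ, ∀ (f : ℝ → Set ℕ) (x : ℝ),
      DecompSat f n φ ψ x (x + (c : ℝ)) ↔ θ.sat f x := by
  cases n with
  | zero =>
    refine ⟨.neg .tt, fun f x => ⟨?_, fun h => absurd trivial h⟩⟩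
    rintro ⟨h, z, h₁, h₂, -⟩
    linarith
  | succ n =>
    obtain ⟨θ, hθ⟩ := Chain.definable hdense n c c.2 hc (fun i f => (φ (i + 1)).sat f)
      (fun i f => (ψ (i + 1)).sat f) (fun i => ⟨_, fun _ _ => Iff.rfl⟩)
      (fun i => ⟨_, fun _ _ => Iff.rfl⟩)
    refine ⟨θ, fun f x => Iff.trans ?_ (hθ f x)⟩
    have := delta_iff_chain (n := n) (φ := fun i => (φ i).sat f) (ψ := fun i => (ψ i).sat f)
      (x := x) (y := x + c)
    exact ⟨fun h => this.1 h.2, fun h => ⟨h.lt, this.2 h⟩⟩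

end MTLPaper
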